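/- arXiv:2202.09104 — 2 statements merged into one kernel-verified Lean document; each statement's English description precedes it below -/
import Mathlib

section
/- Let A be a central arrangement in V, Z ∈ L(A), and let ψ_1 : K(A) → K(A^Z) be the map sending (α_H)_{H∈A} to the tuple whose K-th coordinate (K ∈ A^Z) is Σ_{H ∈ A_K ∖ A_Z} α_H|_Z. Then the induced map ψ̃_1 : F(A) → F(A^Z) between the kernels of the summation maps π_1 : K(A) → V* and π_1^Z : K(A^Z) → Z* is surjective. -/
open Submodule

section ArrangementBasics

variable {𝕂 : Type*} [Field 𝕂] {V : Type*} [AddCommGroup V] [Module 𝕂 V]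

/-- `H` is a (linear) hyperplane: the kernel of a nonzero linear form. -/
def IsHyperplane (H : Submodule 𝕂 V) : Prop :=
  ∃ f : Module.Dual 𝕂 V, f ≠ 0 ∧ LinearMap.ker f = H

/-- A central arrangement: a finite set of linear hyperplanes. -/
def IsArrangement (A : Set (Submodule 𝕂 V)) : Prop :=
  A.Finite ∧ ∀ H ∈ A, IsHyperplane H

/-- The intersection lattice `L(A)`: all intersections of subsets of `A`
(with the ambient space `⊤ = sInf ∅` included). -/
def interLattice (A : Set (Submodule 𝕂 V)) : Set (Submodule 𝕂 V) :=
  {X | ∃ B ⊆ A, X = sInf B}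

/-- The rank of an intersection: its codimension in the ambient space. -/
noncomputable def rk (X : Submodule 𝕂 V) : ℕ := Module.finrank 𝕂 (V ⧸ X)

/-- The localization `A_X` of `A` at `X`: all hyperplanes of `A` containing `X`. -/
def locz (A : Set (Submodule 𝕂 V)) (X : Submodule 𝕂 V) : Set (Submodule 𝕂 V) :=
  {H | H ∈ A ∧ X ≤ H}

/-- The restriction `A^Z` of `A` to `Z`, an arrangement in (the vector space) `Z`:
the subspaces `Z ∩ H` for `H ∈ A ∖ A_Z`, viewed as submodules of `Z`. -/
def restr (A : Set (Submodule 𝕂 V)) (Z : Submodule 𝕂 V) : Set (Submodule 𝕂 ↥Z) :=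
  {K | ∃ H ∈ A, ¬ Z ≤ H ∧ K = (Z ⊓ H).comap Z.subtype}

/-- `α` is a choice of defining linear forms for the arrangement `A`. -/
def IsDefiningForms (A : Set (Submodule 𝕂 V)) (α : Submodule 𝕂 V → Module.Dual 𝕂 V) : Prop :=
  ∀ H ∈ A, LinearMap.ker (α H) = H

/-- The relation space `F(A)` with respect to the chosen defining forms `α`:
the kernel of `⊕_{H ∈ A} 𝕂·e_H → V*`, `e_H ↦ α_H`, realized as the space of finitely
supported coefficient functions supported on `A` whose linear combination vanishes. -/
noncomputable def relSpace (A : Set (Submodule 𝕂 V)) (α : Submodule 𝕂 V → Module.Dual 𝕂 V) :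
    Submodule 𝕂 (Submodule 𝕂 V →₀ 𝕂) :=
  Finsupp.supported 𝕂 𝕂 A ⊓ LinearMap.ker (Finsupp.linearCombination 𝕂 α)

/-- `F_2(A)`: the span of the elements of `F(A)` of length at most `3`. -/
noncomputable def relSpace2 (A : Set (Submodule 𝕂 V)) (α : Submodule 𝕂 V → Module.Dual 𝕂 V) :
    Submodule 𝕂 (Submodule 𝕂 V →₀ 𝕂) :=
  Submodule.span 𝕂 {c | c ∈ relSpace A α ∧ c.support.card ≤ 3}

/-- `A` is formal if `F_2(A) = F(A)` (for any choice of defining forms). -/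
def IsFormal (A : Set (Submodule 𝕂 V)) : Prop :=
  ∀ α : Submodule 𝕂 V → Module.Dual 𝕂 V,
    IsDefiningForms A α → relSpace2 A α = relSpace A α

end ArrangementBasics


section RelationComplex

variable {𝕂 : Type*} [Field 𝕂] {V : Type*} [AddCommGroup V] [Module 𝕂 V]

/-- `K(A) = ⊕_{H ∈ A} Ann_{V*}(H)`, realized as tuples of linear forms indexed by the
hyperplanes: functions `α` with `α H ∈ Ann_{V*}(H)` for all `H`, supported on `A`. -/
def KK (A : Set (Submodule 𝕂 V)) : Set (Submodule 𝕂 V → Module.Dual 𝕂 V) :=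
  {α | ∀ H, α H ∈ H.dualAnnihilator ∧ (H ∉ A → α H = 0)}

/-- The summation map `π₁ : K(A) → V*`, `(α_H)_H ↦ Σ_H α_H`. -/
noncomputable def sumK (α : Submodule 𝕂 V → Module.Dual 𝕂 V) : Module.Dual 𝕂 V :=
  ∑ᶠ H, α H

/-- The relation space `F(A) = ker π₁` (as a subset of `K(A)`). -/
def FF (A : Set (Submodule 𝕂 V)) : Set (Submodule 𝕂 V → Module.Dual 𝕂 V) :=
  {α | α ∈ KK A ∧ sumK α = 0}

open Classical in
/-- The map `ψ₁ : K(A) → K(A^Z)` whose `K`-th coordinate (`K ∈ A^Z`) is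
`Σ_{H ∈ A_K ∖ A_Z} α_H|_Z`. -/
noncomputable def psi1 (A : Set (Submodule 𝕂 V)) (Z : Submodule 𝕂 V)
    (α : Submodule 𝕂 V → Module.Dual 𝕂 V) :
    Submodule 𝕂 ↥Z → Module.Dual 𝕂 ↥Z :=
  fun K =>
    if K ∈ restr A Z then
      ∑ᶠ H ∈ {H | H ∈ A ∧ K.map Z.subtype ≤ H ∧ ¬ Z ≤ H}, Z.subtype.dualMap (α H)
    else 0

end RelationComplex

section RelationSpaces

variable {𝕂 : Type*} [Field 𝕂] {V : Type*} [AddCommGroup V] [Module 𝕂 V]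

theorem sumK_eq_sum {A : Set (Submodule 𝕂 V)} (hA : A.Finite)
    {α : Submodule 𝕂 V → Module.Dual 𝕂 V} (hα : α ∈ KK A) :
    sumK α = ∑ H ∈ hA.toFinset, α H :=
  finsum_eq_sum_of_support_subset_of_finite α
    (fun H hH => by_contra fun hHA => hH ((hα H).2 hHA)) hA

theorem finite_restr {A : Set (Submodule 𝕂 V)} (hA : A.Finite) (Z : Submodule 𝕂 V) :
    (restr A Z).Finite := by
  refine (hA.image fun H => H.comap Z.subtype).subset ?_
  rintro K ⟨H, hH, -, rfl⟩
  exact ⟨H, hH, by simp⟩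

theorem mem_restr_iff {A : Set (Submodule 𝕂 V)} {Z : Submodule 𝕂 V} {K : Submodule 𝕂 Z} :
    K ∈ restr A Z ↔ ∃ H ∈ A, ¬ Z ≤ H ∧ H.comap Z.subtype = K := by
  simp [restr, eq_comm]

theorem dualMap_subtype_eq_zero {Z H : Submodule 𝕂 V} {f : Module.Dual 𝕂 V}
    (hf : f ∈ H.dualAnnihilator) (h : Z ≤ H) : Z.subtype.dualMap f = 0 := by
  ext z
  exact (Submodule.mem_dualAnnihilator f).1 hf _ (h z.2)

/-- Two hyperplanes not containing `Z` have nested traces on `Z` only if the traces agree. -/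
theorem comap_subtype_eq_of_le {H H' Z : Submodule 𝕂 V} (hH : IsHyperplane H)
    (hZ' : ¬ Z ≤ H') (h : H.comap Z.subtype ≤ H'.comap Z.subtype) :
    H.comap Z.subtype = H'.comap Z.subtype := by
  obtain ⟨f, -, rfl⟩ := hH
  refine le_antisymm h fun z hz => ?_
  by_contra hfz
  have hfz' : f z ≠ 0 := hfz
  refine hZ' fun v hv => ?_
  have hw : (⟨v, hv⟩ - (f v / f z) • z : Z) ∈ H'.comap Z.subtype := h (by simp [hfz'])
  have hv' := add_mem hw (Submodule.smul_mem _ (f v / f z) hz)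
  simpa using hv'

open Classical in
theorem psi1_apply {A : Set (Submodule 𝕂 V)} (hA : IsArrangement A) (Z : Submodule 𝕂 V)
    (α : Submodule 𝕂 V → Module.Dual 𝕂 V) {K : Submodule 𝕂 Z} (hK : K ∈ restr A Z) :
    psi1 A Z α K =
      ∑ H ∈ (hA.1.toFinset.filter fun H => ¬ Z ≤ H) with H.comap Z.subtype = K,
        Z.subtype.dualMap (α H) := by
  rw [psi1, if_pos hK]
  obtain ⟨H₀, hH₀, -, rfl⟩ := mem_restr_iff.1 hK
  refine finsum_mem_eq_sum_of_inter_support_eq _ ?_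
  congr 1
  ext H
  simp only [Set.mem_ofPred_eq, Finset.coe_filter, Finset.mem_filter, Set.Finite.mem_toFinset,
    Submodule.map_le_iff_le_comap]
  constructor
  · rintro ⟨hH, hle, hZ⟩
    exact ⟨⟨hH, hZ⟩, (comap_subtype_eq_of_le (hA.2 _ hH₀) hZ hle).symm⟩
  · rintro ⟨⟨hH, hZ⟩, heq⟩
    exact ⟨hH, heq.ge, hZ⟩

theorem psi1_mem_KK {A : Set (Submodule 𝕂 V)} (hA : IsArrangement A) (Z : Submodule 𝕂 V)
    {α : Submodule 𝕂 V → Module.Dual 𝕂 V} (hα : α ∈ KK A) :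
    psi1 A Z α ∈ KK (restr A Z) := by
  classical
  refine fun K => ⟨?_, fun hK => if_neg hK⟩
  by_cases hK : K ∈ restr A Z
  · rw [psi1_apply hA Z α hK]
    refine sum_mem fun H hH => (Submodule.mem_dualAnnihilator _).2 fun z hz => ?_
    rw [← (Finset.mem_filter.1 hH).2] at hz
    exact (Submodule.mem_dualAnnihilator _).1 (hα H).1 _ hz
  · rw [psi1, if_neg hK]
    exact zero_mem _

theorem sumK_psi1 {A : Set (Submodule 𝕂 V)} (hA : IsArrangement A) (Z : Submodule 𝕂 V)
    {α : Submodule 𝕂 V → Module.Dual 𝕂 V} (hα : α ∈ KK A) :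
    sumK (psi1 A Z α) = Z.subtype.dualMap (sumK α) := by
  classical
  rw [sumK_eq_sum (finite_restr hA.1 Z) (psi1_mem_KK hA Z hα), sumK_eq_sum hA.1 hα, map_sum,
    Finset.sum_congr rfl fun K hK =>
      psi1_apply hA Z α ((finite_restr hA.1 Z).mem_toFinset.1 hK),
    Finset.sum_fiberwise_of_maps_to, Finset.sum_filter_of_ne]
  · exact fun H _ hne hle => hne (dualMap_subtype_eq_zero (hα H).1 hle)
  · intro H hH
    rw [Finset.mem_filter, Set.Finite.mem_toFinset] at hH
    exact (Set.Finite.mem_toFinset _).2 (mem_restr_iff.2 ⟨H, hH.1, hH.2, rfl⟩)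

/-- A form on `Z` vanishing on `Z ∩ H` extends to a form on `V` vanishing on the
hyperplane `H`. -/
theorem exists_dualMap_subtype_eq {H Z : Submodule 𝕂 V} (hH : IsHyperplane H)
    {b : Module.Dual 𝕂 Z} (hb : b ∈ (H.comap Z.subtype).dualAnnihilator) :
    ∃ a ∈ H.dualAnnihilator, Z.subtype.dualMap a = b := by
  obtain ⟨f, -, rfl⟩ := hH
  rw [← LinearMap.ker_comp, ← LinearMap.range_dualMap_eq_dualAnnihilator_ker] at hb
  obtain ⟨φ, rfl⟩ := hb
  refine ⟨φ ∘ₗ f, (Submodule.mem_dualAnnihilator _).2 fun v hv => ?_, rfl⟩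
  simp [LinearMap.mem_ker.1 hv]

/-- The annihilator of `Z ∈ L(A)` is spanned by the annihilators of the hyperplanes
containing `Z`. -/
theorem exists_sumK_eq_of_mem_dualAnnihilator {A : Set (Submodule 𝕂 V)} (hA : A.Finite)
    {Z : Submodule 𝕂 V} (hZ : Z ∈ interLattice A) {f : Module.Dual 𝕂 V}
    (hf : f ∈ Z.dualAnnihilator) :
    ∃ γ ∈ KK A, (∀ H, ¬ Z ≤ H → γ H = 0) ∧ sumK γ = f := by
  classical
  obtain ⟨B, hBA, rfl⟩ := hZ
  have hB : B.Finite := hA.subset hBA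
  have : Finite B := hB
  rw [sInf_eq_iInf', Subspace.dualAnnihilator_iInf_eq, iSup_subtype] at hf
  have hf' : f ∈ ⨆ H ∈ hB.toFinset, H.dualAnnihilator := by
    simpa only [Set.Finite.mem_toFinset] using hf
  obtain ⟨μ, rfl⟩ := (Submodule.mem_iSup_finset_iff_exists_sum _ _).1 hf'
  have hγ : (fun H => if H ∈ B then (μ H : Module.Dual 𝕂 V) else 0) ∈ KK B := fun H => by
    by_cases hH : H ∈ B <;> simp [hH]
  refine ⟨_, fun H => ⟨(hγ H).1, fun hH => (hγ H).2 fun h => hH (hBA h)⟩,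
    fun H hH => (hγ H).2 fun h => hH (sInf_le h), ?_⟩
  rw [sumK_eq_sum hB hγ]
  exact Finset.sum_congr rfl fun H hH => if_pos (hB.mem_toFinset.1 hH)

theorem KK_sub_mem {A : Set (Submodule 𝕂 V)} {α γ : Submodule 𝕂 V → Module.Dual 𝕂 V}
    (hα : α ∈ KK A) (hγ : γ ∈ KK A) : α - γ ∈ KK A := fun H =>
  ⟨sub_mem (hα H).1 (hγ H).1, fun hH => by simp [(hα H).2 hH, (hγ H).2 hH]⟩

theorem psi1_congr {A : Set (Submodule 𝕂 V)} {Z : Submodule 𝕂 V}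
    {α α' : Submodule 𝕂 V → Module.Dual 𝕂 V} (h : ∀ H, ¬ Z ≤ H → α H = α' H) :
    psi1 A Z α = psi1 A Z α' := by
  funext K
  unfold psi1
  congr 1
  exact finsum_mem_congr rfl fun H hH => by rw [h H hH.2.2]

theorem psi1_surjOn_KK {A : Set (Submodule 𝕂 V)} (hA : IsArrangement A) (Z : Submodule 𝕂 V) :
    Set.SurjOn (psi1 A Z) (KK A) (KK (restr A Z)) := by
  classical
  intro β hβ
  have hg : ∀ K : Submodule 𝕂 Z, ∃ H, K ∈ restr A Z →
      H ∈ A ∧ ¬ Z ≤ H ∧ H.comap Z.subtype = K := fun K => by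
    by_cases hK : K ∈ restr A Z
    · obtain ⟨H, hH⟩ := mem_restr_iff.1 hK
      exact ⟨H, fun _ => hH⟩
    · exact ⟨⊤, fun h => absurd h hK⟩
  choose g hg using hg
  have ha : ∀ K : Submodule 𝕂 Z, ∃ a, K ∈ restr A Z →
      a ∈ (g K).dualAnnihilator ∧ Z.subtype.dualMap a = β K := fun K => by
    by_cases hK : K ∈ restr A Z
    · obtain ⟨hgA, -, hgK⟩ := hg K hK
      have hβK : β K ∈ ((g K).comap Z.subtype).dualAnnihilator := by
        rw [hgK]
        exact (hβ K).1
      obtain ⟨a, ha⟩ := exists_dualMap_subtype_eq (hA.2 _ hgA) hβK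
      exact ⟨a, fun _ => ha⟩
    · exact ⟨0, fun h => absurd h hK⟩
  choose a ha using ha
  refine ⟨fun H => if H ∈ A ∧ ¬ Z ≤ H ∧ g (H.comap Z.subtype) = H
    then a (H.comap Z.subtype) else 0, fun H => ⟨?_, fun hH => if_neg fun h => hH h.1⟩, ?_⟩
  · dsimp only
    split_ifs with h
    · have := (ha _ (mem_restr_iff.2 ⟨H, h.1, h.2.1, rfl⟩)).1
      rwa [h.2.2] at this
    · exact zero_mem _
  · funext K
    by_cases hK : K ∈ restr A Z
    · obtain ⟨hgA, hgZ, hgK⟩ := hg K hK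
      rw [psi1_apply hA Z _ hK, Finset.sum_eq_single (g K)]
      · rw [if_pos ⟨hgA, hgZ, by rw [hgK]⟩, hgK, (ha K hK).2]
      · intro H hH hne
        rw [if_neg, map_zero]
        rintro ⟨-, -, h⟩
        rw [(Finset.mem_filter.1 hH).2] at h
        exact hne h.symm
      · intro h
        exact absurd (by simp [hgA, hgZ, hgK]) h
    · rw [psi1, if_neg hK, (hβ K).2 hK]

end RelationSpaces

/-- **Proposition 4.2** (`prop:tpsi1`): the map `ψ̃₁ : F(A) → F(A^Z)` induced by `ψ₁`
between the kernels of the summation maps `π₁` and `π₁^Z` is (well defined and)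
surjective. -/
theorem psi1_induced_map_on_relation_spaces_surjective {𝕂 : Type*} [Field 𝕂] {ℓ : ℕ}
    (A : Set (Submodule 𝕂 (Fin ℓ → 𝕂))) (hA : IsArrangement A)
    (Z : Submodule 𝕂 (Fin ℓ → 𝕂)) (hZ : Z ∈ interLattice A) :
    Set.MapsTo (psi1 A Z) (FF A) (FF (restr A Z)) ∧
    Set.SurjOn (psi1 A Z) (FF A) (FF (restr A Z)) := by
  refine ⟨fun α hα => ⟨psi1_mem_KK hA Z hα.1, by rw [sumK_psi1 hA Z hα.1, hα.2, map_zero]⟩, ?_⟩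
  rintro β ⟨hβ, hβ0⟩
  obtain ⟨α, hα, rfl⟩ := psi1_surjOn_KK hA Z hβ
  rw [sumK_psi1 hA Z hα] at hβ0
  have hann : sumK α ∈ Z.dualAnnihilator :=
    (Submodule.mem_dualAnnihilator _).2 fun z hz => LinearMap.congr_fun hβ0 ⟨z, hz⟩
  obtain ⟨γ, hγ, hγZ, hγα⟩ := exists_sumK_eq_of_mem_dualAnnihilator hA.1 hZ hann
  refine ⟨α - γ, ⟨KK_sub_mem hα hγ, ?_⟩, psi1_congr fun H hH => by simp [hγZ H hH]⟩
  rw [sumK_eq_sum hA.1 hα, sumK_eq_sum hA.1 hγ] at hγα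
  rw [sumK_eq_sum hA.1 (KK_sub_mem hα hγ)]
  simp [hγα]
end

section
/- Let A be a central arrangement of rank r and let X ∈ L(A) be a modular element of rank r−1 (corank 1). Then the localization A_X is formal if and only if A is formal. -/
open Submodule

/-- An element `X ∈ L(A)` is modular if `X + Y ∈ L(A)` for every `Y ∈ L(A)`. -/
def IsModular {𝕂 : Type*} [Field 𝕂] {V : Type*} [AddCommGroup V] [Module 𝕂 V]
    (A : Set (Submodule 𝕂 V)) (X : Submodule 𝕂 V) : Prop :=
  ∀ Y ∈ interLattice A, X ⊔ Y ∈ interLattice A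

section RelationSpaces

variable {𝕂 : Type*} [Field 𝕂] {V : Type*} [AddCommGroup V] [Module 𝕂 V]
  {A B : Set (Submodule 𝕂 V)} {α β : Submodule 𝕂 V → Module.Dual 𝕂 V}

theorem mem_relSpace {c : Submodule 𝕂 V →₀ 𝕂} :
    c ∈ relSpace A α ↔
      c ∈ Finsupp.supported 𝕂 𝕂 A ∧ Finsupp.linearCombination 𝕂 α c = 0 :=
  Iff.rfl

theorem relSpace2_le_relSpace : relSpace2 A α ≤ relSpace A α :=
  Submodule.span_le.2 fun _ hc => hc.1

theorem relSpace_mono (h : B ⊆ A) : relSpace B α ≤ relSpace A α :=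
  inf_le_inf_right _ (Finsupp.supported_mono h)

theorem relSpace2_mono (h : B ⊆ A) : relSpace2 B α ≤ relSpace2 A α :=
  Submodule.span_mono fun _ hc => ⟨relSpace_mono h hc.1, hc.2⟩

theorem relSpace_congr (h : ∀ H ∈ A, α H = β H) : relSpace A α = relSpace A β := by
  ext c
  rw [mem_relSpace, mem_relSpace]
  refine and_congr_right fun hc => ?_
  rw [Finsupp.linearCombination_apply, Finsupp.linearCombination_apply,
    Finsupp.sum_congr (g2 := fun H a => a • β H) fun H hH => by rw [h H (hc hH)]]

theorem relSpace2_congr (h : ∀ H ∈ A, α H = β H) : relSpace2 A α = relSpace2 A β := by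
  rw [relSpace2, relSpace2, relSpace_congr h]

theorem locz_subset (X : Submodule 𝕂 V) : locz A X ⊆ A := fun _ h => h.1

theorem IsDefiningForms.mono (h : B ⊆ A) (hα : IsDefiningForms A α) : IsDefiningForms B α :=
  fun H hH => hα H (h hH)

theorem IsArrangement.exists_isDefiningForms (hA : IsArrangement A) :
    ∃ α : Submodule 𝕂 V → Module.Dual 𝕂 V, IsDefiningForms A α := by
  classical
  choose f _ hf using hA.2
  exact ⟨fun H => if h : H ∈ A then f H h else 0, fun H hH => by simp [hH, hf H hH]⟩

/-- Formality may be tested on those defining forms of `B` that also define the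
hyperplanes of an arrangement `A`. -/
theorem isFormal_of_forall_isDefiningForms (hA : IsArrangement A)
    (h : ∀ α : Submodule 𝕂 V → Module.Dual 𝕂 V,
      IsDefiningForms A α → relSpace2 B α = relSpace B α) : IsFormal B := by
  classical
  intro α hα
  obtain ⟨β, hβ⟩ := hA.exists_isDefiningForms
  have heq : ∀ H ∈ B, α H = (if H ∈ B then α H else β H) := fun H hH => by simp [hH]
  rw [relSpace_congr heq, relSpace2_congr heq]
  refine h _ fun H hH => ?_
  by_cases hB : H ∈ B
  · simpa [hB] using hα H hB
  · simpa [hB] using hβ H hH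

/-- A corank one subspace above the center is the sum of the center and the line through any
of its vectors outside the center. -/
theorem le_of_rk_eq_sub_one [FiniteDimensional 𝕂 V] {T X Z : Submodule 𝕂 V} {x : V}
    (hTX : T ≤ X) (hrk : rk X = rk T - 1) (hx : x ∈ X) (hxT : x ∉ T)
    (hTZ : T ≤ Z) (hxZ : x ∈ Z) : X ≤ Z := by
  have hlt : T < T ⊔ span 𝕂 {x} := by
    refine lt_of_le_of_ne le_sup_left fun h => hxT ?_
    rw [h]
    exact mem_sup_right (mem_span_singleton_self x)
  have hle : T ⊔ span 𝕂 {x} ≤ X := sup_le hTX (by simpa using hx)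
  have h1 := Submodule.finrank_lt_finrank_of_lt hlt
  have h2 := Submodule.finrank_quotient_add_finrank T
  have h3 := Submodule.finrank_quotient_add_finrank X
  have h4 := Submodule.finrank_mono hle
  unfold rk at hrk
  rw [← Submodule.eq_of_le_of_finrank_le hle (by omega)]
  exact sup_le hTZ (by simpa using hxZ)

theorem exists_smul_eq_of_ker_le_ker {f g : Module.Dual 𝕂 V} (hg : g ≠ 0)
    (h : LinearMap.ker f ≤ LinearMap.ker g) : ∃ d : 𝕂, d • g = f := by
  obtain ⟨v, hv⟩ : ∃ v, g v ≠ 0 := by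
    by_contra! h0
    exact hg (LinearMap.ext h0)
  have hfv : f v ≠ 0 := fun h0 => hv (h h0)
  refine ⟨f v / g v, LinearMap.ext fun w => ?_⟩
  have hw : w - (f w / f v) • v ∈ LinearMap.ker f := by
    simp [hfv]
  have := h hw
  simp only [LinearMap.mem_ker, map_sub, map_smul, smul_eq_mul, sub_eq_zero] at this
  simp only [LinearMap.smul_apply, smul_eq_mul, this]
  field_simp

/-- Subtracting from `α H` the multiple of `α H₀` that makes it vanish at `x ∈ X` gives a
multiple of a single form of the localization at the modular element `X`. -/
theorem exists_smul_eq_sub_of_isModular [FiniteDimensional 𝕂 V] (hA : IsArrangement A)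
    {X : Submodule 𝕂 V} (hTX : sInf A ≤ X) (hmod : IsModular A X)
    (hrk : rk X = rk (sInf A) - 1) (hα : IsDefiningForms A α) {H₀ : Submodule 𝕂 V} (hH₀ : H₀ ∈ A)
    {x : V} (hx : x ∈ X) (hx₀ : α H₀ x ≠ 0) {H : Submodule 𝕂 V} (hH : H ∈ A) :
    ∃ (K : Submodule 𝕂 V) (d : 𝕂), Finsupp.single K d ∈ Finsupp.supported 𝕂 𝕂 (locz A X) ∧
      d • α K = α H - (α H x / α H₀ x) • α H₀ ∧ (H ∈ locz A X → K = H ∧ d = 1) := by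
  by_cases hHX : H ∈ locz A X
  · have h0 : α H x = 0 := by
      have : x ∈ LinearMap.ker (α H) := by rw [hα H hH]; exact hHX.2 hx
      simpa using this
    exact ⟨H, 1, Finsupp.single_mem_supported 𝕂 1 hHX, by simp [h0], fun _ => ⟨rfl, rfl⟩⟩
  set g := α H - (α H x / α H₀ x) • α H₀ with hg
  by_cases hg0 : g = 0
  · exact ⟨H, 0, by simp, by simp [hg0], fun h => absurd h hHX⟩
  have hmem : ∀ {K : Submodule 𝕂 V}, K ∈ A → ∀ v, v ∈ K ↔ α K v = 0 := fun {K} hK v => by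
    rw [← LinearMap.mem_ker, hα K hK]
  have hgx : g x = 0 := by simp [hg, hx₀]
  have hXg : X ≤ LinearMap.ker g := by
    refine le_of_rk_eq_sub_one hTX hrk hx (fun h => hx₀ ?_) (fun v hv => ?_) hgx
    · exact (hmem hH₀ x).1 (mem_sInf.1 h _ hH₀)
    · have h1 := (hmem hH v).1 (mem_sInf.1 hv _ hH)
      have h2 := (hmem hH₀ v).1 (mem_sInf.1 hv _ hH₀)
      simp [hg, h1, h2]
  have hker : LinearMap.ker g ≤ X ⊔ H ⊓ H₀ := by
    intro v hv
    rw [← add_sub_cancel ((α H₀ v / α H₀ x) • x) v]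
    refine add_mem (mem_sup_left (X.smul_mem _ hx)) (mem_sup_right ?_)
    have hv0 : α H v = α H x / α H₀ x * α H₀ v := by
      simpa [hg, sub_eq_zero] using hv
    refine ⟨(hmem hH _).2 ?_, (hmem hH₀ _).2 ?_⟩
    · simp only [map_sub, map_smul, smul_eq_mul, hv0]
      ring
    · simp [hx₀]
  obtain ⟨B, hBA, hB⟩ := hmod (H ⊓ H₀)
    ⟨{H, H₀}, by simp [Set.insert_subset_iff, hH, hH₀], by simp⟩
  have hBne : B.Nonempty := by
    rw [Set.nonempty_iff_ne_empty]
    rintro rfl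
    refine hg0 (LinearMap.ker_eq_top.1 (top_le_iff.1 ?_))
    rw [sInf_empty] at hB
    rw [← hB]
    refine sup_le hXg fun v hv => ?_
    simp [hg, (hmem hH v).1 hv.1, (hmem hH₀ v).1 hv.2]
  obtain ⟨K, hK⟩ := hBne
  have hKA := hBA hK
  have hle : X ⊔ H ⊓ H₀ ≤ K := hB ▸ sInf_le hK
  have hαK : α K ≠ 0 := by
    obtain ⟨f, hf, hfK⟩ := hA.2 K hKA
    intro h0
    apply hf
    rw [← LinearMap.ker_eq_top, hfK, ← hα K hKA, h0, LinearMap.ker_zero]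
  obtain ⟨d, hd⟩ := exists_smul_eq_of_ker_le_ker hαK (hα K hKA ▸ hker.trans hle)
  exact ⟨K, d, Finsupp.single_mem_supported 𝕂 d ⟨hKA, le_sup_left.trans hle⟩, hd,
    fun h => absurd h hHX⟩

theorem relSpace2_locz_eq_iff_of_isModular [FiniteDimensional 𝕂 V] (hA : IsArrangement A)
    {X : Submodule 𝕂 V} (hTX : sInf A ≤ X) (hmod : IsModular A X)
    (hrk : rk X = rk (sInf A) - 1) (hα : IsDefiningForms A α) :
    relSpace2 (locz A X) α = relSpace (locz A X) α ↔ relSpace2 A α = relSpace A α := by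
  classical
  by_cases hloc : ∀ H ∈ A, X ≤ H
  · rw [show locz A X = A from Set.Subset.antisymm (locz_subset X) fun H h => ⟨h, hloc H h⟩]
  push Not at hloc
  obtain ⟨H₀, hH₀, hXH₀⟩ := hloc
  obtain ⟨x, hx, hxH₀⟩ := SetLike.not_le_iff_exists.1 hXH₀
  have hx₀ : α H₀ x ≠ 0 := fun h => hxH₀ (by rw [← hα H₀ hH₀]; exact h)
  have key : ∀ H, ∃ (K : Submodule 𝕂 V) (d : 𝕂), H ∈ A →
      Finsupp.single K d ∈ Finsupp.supported 𝕂 𝕂 (locz A X) ∧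
      d • α K = α H - (α H x / α H₀ x) • α H₀ ∧ (H ∈ locz A X → K = H ∧ d = 1) := by
    intro H
    by_cases hH : H ∈ A
    · obtain ⟨K, d, h⟩ := exists_smul_eq_sub_of_isModular hA hTX hmod hrk hα hH₀ hx hx₀ hH
      exact ⟨K, d, fun _ => h⟩
    · exact ⟨H, 0, fun h => absurd h hH⟩
  choose p d hpd using key
  let retr : (Submodule 𝕂 V →₀ 𝕂) →ₗ[𝕂] (Submodule 𝕂 V →₀ 𝕂) :=
    Finsupp.linearCombination 𝕂 fun H => Finsupp.single (p H) (d H)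
  have retr_apply : ∀ c, retr c = ∑ H ∈ c.support, c H • Finsupp.single (p H) (d H) :=
    fun c => Finsupp.linearCombination_apply 𝕂 c
  have retr_supported : ∀ c ∈ Finsupp.supported 𝕂 𝕂 A,
      retr c ∈ Finsupp.supported 𝕂 𝕂 (locz A X) := fun c hc => by
    rw [retr_apply]
    exact sum_mem fun H hH => smul_mem _ _ (hpd H (hc hH)).1
  have retr_card : ∀ c, (retr c).support.card ≤ c.support.card := fun c => by
    refine le_trans (Finset.card_le_card ?_) (Finset.card_image_le (f := p))
    suffices h : retr c ∈ Finsupp.supported 𝕂 𝕂 (c.support.image p : Set (Submodule 𝕂 V)) from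
      Finset.coe_subset.1 h
    rw [retr_apply]
    exact sum_mem fun H hH => smul_mem _ _
      (Finsupp.single_mem_supported 𝕂 _ (Finset.mem_coe.2 (Finset.mem_image_of_mem p hH)))
  have retr_relSpace : ∀ c ∈ relSpace A α, retr c ∈ relSpace (locz A X) α := fun c hc => by
    refine mem_relSpace.2 ⟨retr_supported c hc.1, ?_⟩
    have h0 : ∑ H ∈ c.support, c H • α H = 0 := hc.2
    have h1 : ∑ H ∈ c.support, c H * α H x = 0 := by
      simpa using LinearMap.congr_fun h0 x
    rw [retr_apply, map_sum]
    calc _ = ∑ H ∈ c.support, (c H • α H - ((c H * α H x) * (α H₀ x)⁻¹) • α H₀) := by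
          refine Finset.sum_congr rfl fun H hH => ?_
          rw [map_smul, Finsupp.linearCombination_single, (hpd H (hc.1 hH)).2.1, smul_sub,
            smul_smul, div_eq_mul_inv, mul_assoc]
      _ = 0 := by
          rw [Finset.sum_sub_distrib, h0, ← Finset.sum_smul, ← Finset.sum_mul, h1]
          simp
  constructor
  · intro hX
    refine le_antisymm relSpace2_le_relSpace fun c hc => ?_
    let e : Submodule 𝕂 V → (Submodule 𝕂 V →₀ 𝕂) := fun H =>
      Finsupp.single H 1 - Finsupp.single (p H) (d H) - Finsupp.single H₀ (α H x / α H₀ x)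
    have he : ∀ H ∈ A, e H ∈ relSpace2 A α := fun H hH => by
      refine subset_span ⟨⟨sub_mem (sub_mem ?_ ?_) ?_, ?_⟩, ?_⟩
      · exact Finsupp.single_mem_supported 𝕂 _ hH
      · exact Finsupp.supported_mono (locz_subset X) (hpd H hH).1
      · exact Finsupp.single_mem_supported 𝕂 _ hH₀
      · simp [e, (hpd H hH).2.1]
      · refine le_trans (Finset.card_le_card (t := {H, p H, H₀}) fun K hK => ?_)
          Finset.card_le_three
        by_contra hK'
        simp only [Finset.mem_insert, Finset.mem_singleton, not_or] at hK'
        rw [Finsupp.mem_support_iff] at hK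
        exact hK (by simp [e, Ne.symm hK'.1, Ne.symm hK'.2.1, Ne.symm hK'.2.2])
    have hsum : ∑ H ∈ c.support, c H • e H ∈ relSpace2 A α :=
      sum_mem fun H hH => smul_mem _ _ (he H (hc.1 hH))
    have h0 : ∑ H ∈ c.support, c H * α H x = 0 := by
      have : ∑ H ∈ c.support, c H • α H = 0 := hc.2
      simpa using LinearMap.congr_fun this x
    have hdecomp : c = ∑ H ∈ c.support, c H • e H + retr c := by
      have h1 : ∑ H ∈ c.support, c H • Finsupp.single H (1 : 𝕂) = c := by
        simpa [Finsupp.sum] using Finsupp.sum_single c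
      have h2 : ∑ H ∈ c.support, c H • Finsupp.single H₀ (α H x / α H₀ x) = 0 := by
        simp only [Finsupp.smul_single, smul_eq_mul, ← mul_div_assoc]
        rw [← Finsupp.single_finsetSum, ← Finset.sum_div, h0, zero_div, Finsupp.single_zero]
      simp only [e, smul_sub, Finset.sum_sub_distrib, h1, h2, ← retr_apply]
      abel
    rw [hdecomp]
    refine add_mem hsum (relSpace2_mono (locz_subset X) ?_)
    rw [hX]
    exact retr_relSpace c hc
  · intro hAf
    refine le_antisymm relSpace2_le_relSpace fun c hc => ?_
    have hretr : retr c = c := by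
      rw [retr_apply]
      conv_rhs => rw [← Finsupp.sum_single c, Finsupp.sum]
      refine Finset.sum_congr rfl fun H hH => ?_
      obtain ⟨h1, h2⟩ := (hpd H (hc.1 hH).1).2.2 (hc.1 hH)
      rw [h1, h2, Finsupp.smul_single, smul_eq_mul, mul_one]
    have hc2 : c ∈ relSpace2 A α := hAf ▸ relSpace_mono (locz_subset X) hc
    have hmap : relSpace2 A α ≤ (relSpace2 (locz A X) α).comap retr :=
      span_le.2 fun b hb => subset_span ⟨retr_relSpace b hb.1, (retr_card b).trans hb.2⟩
    exact hretr ▸ hmap hc2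

end RelationSpaces

/-- **Corollary 5.3** (`cor:modular-formal-corank1`): let `A` be a central arrangement of
rank `r` and let `X ∈ L(A)` be modular of rank `r - 1` (corank `1`).  Then the
localization `A_X` is formal if and only if `A` is formal. -/
theorem formal_iff_formal_localization_modular_corank_one {𝕂 : Type*} [Field 𝕂] {ℓ : ℕ}
    (A : Set (Submodule 𝕂 (Fin ℓ → 𝕂))) (hA : IsArrangement A)
    (r : ℕ) (hr : rk (sInf A) = r)
    (X : Submodule 𝕂 (Fin ℓ → 𝕂)) (hX : X ∈ interLattice A) (hmod : IsModular A X)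
    (hrkX : rk X = r - 1) :
    IsFormal (locz A X) ↔ IsFormal A := by
  subst hr
  have hTX : sInf A ≤ X := by
    obtain ⟨B, hB, rfl⟩ := hX
    exact sInf_le_sInf hB
  have key := fun α (hα : IsDefiningForms A α) =>
    relSpace2_locz_eq_iff_of_isModular hA hTX hmod hrkX hα
  refine ⟨fun h α hα => (key α hα).1 (h α (hα.mono (locz_subset X))), fun h => ?_⟩
  exact isFormal_of_forall_isDefiningForms hA fun α hα => (key α hα).2 (h α hα)
end
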